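/- arXiv:2408.15427 — 2 statements merged into one kernel-verified Lean document; each statement's English description precedes it below -/
import Mathlib

section
/- Let z ∈ ℂ and let μ, ν ∈ ℂ satisfy μ² = 1 − z and ν² = 1 + z, and let f₁, g₂, f₃, g₄ be as in the displayed formulas. Then for every x ∈ ℝ the Wronskians satisfy W[f₁, g₂](x) = 2 z² μ, W[f₃, g₄](x) = −2 z² ν, W[f₁, g₄](x) = 0, and W[f₃, g₂](x) = 0. -/
open MeasureTheory

/-- `sech x = 1 / cosh x`. -/
noncomputable def sech (x : ℝ) : ℝ := 1 / Real.cosh x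

/-- The Jost-type solution `f₁(x) = ((μ − tanh x)² e^{μx}, −sech²(x) e^{μx})`. -/
noncomputable def jostF1 (μ : ℂ) : (ℝ → ℂ) × (ℝ → ℂ) :=
  (fun x => (μ - (Real.tanh x : ℂ)) ^ 2 * Complex.exp (μ * (x : ℂ)),
   fun x => -((sech x : ℝ) : ℂ) ^ 2 * Complex.exp (μ * (x : ℂ)))

/-- The Jost-type solution `g₂(x) = ((μ + tanh x)² e^{−μx}, −sech²(x) e^{−μx})`. -/
noncomputable def jostG2 (μ : ℂ) : (ℝ → ℂ) × (ℝ → ℂ) :=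
  (fun x => (μ + (Real.tanh x : ℂ)) ^ 2 * Complex.exp (-μ * (x : ℂ)),
   fun x => -((sech x : ℝ) : ℂ) ^ 2 * Complex.exp (-μ * (x : ℂ)))

/-- The Jost-type solution `f₃(x) = (−sech²(x) e^{−νx}, (ν + tanh x)² e^{−νx})`. -/
noncomputable def jostF3 (ν : ℂ) : (ℝ → ℂ) × (ℝ → ℂ) :=
  (fun x => -((sech x : ℝ) : ℂ) ^ 2 * Complex.exp (-ν * (x : ℂ)),
   fun x => (ν + (Real.tanh x : ℂ)) ^ 2 * Complex.exp (-ν * (x : ℂ)))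

/-- The Jost-type solution `g₄(x) = (−sech²(x) e^{νx}, (ν − tanh x)² e^{νx})`. -/
noncomputable def jostG4 (ν : ℂ) : (ℝ → ℂ) × (ℝ → ℂ) :=
  (fun x => -((sech x : ℝ) : ℂ) ^ 2 * Complex.exp (ν * (x : ℂ)),
   fun x => (ν - (Real.tanh x : ℂ)) ^ 2 * Complex.exp (ν * (x : ℂ)))

/-- The Wronskian `W[f,g](x) = f₁′g₁ + f₂′g₂ − f₁g₁′ − f₂g₂′` (real scalar product of `ℂ²`,
no complex conjugation). -/
noncomputable def Wronskian (f g : (ℝ → ℂ) × (ℝ → ℂ)) (x : ℝ) : ℂ :=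
  deriv f.1 x * g.1 x + deriv f.2 x * g.2 x - f.1 x * deriv g.1 x - f.2 x * deriv g.2 x

lemma sech_sq (x : ℝ) : sech x ^ 2 = 1 - Real.tanh x ^ 2 := by
  have h := (Real.cosh_pos x).ne'
  rw [sech, Real.tanh_eq_sinh_div_cosh]
  field_simp
  linarith [Real.cosh_sq x]

lemma ofReal_sech_sq (x : ℝ) : (sech x : ℂ) ^ 2 = 1 - (Real.tanh x : ℂ) ^ 2 := by
  exact_mod_cast congrArg (fun y : ℝ => (y : ℂ)) (sech_sq x)

lemma hasDerivAt_ofReal_tanh (x : ℝ) :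
    HasDerivAt (fun y : ℝ => (Real.tanh y : ℂ)) (1 - (Real.tanh x : ℂ) ^ 2) x := by
  have h : HasDerivAt Real.tanh (1 - Real.tanh x ^ 2) x := by
    have hc := (Real.cosh_pos x).ne'
    have hd := (Real.hasDerivAt_sinh x).div (Real.hasDerivAt_cosh x) hc
    have hfun : Real.tanh = Real.sinh / Real.cosh := funext Real.tanh_eq_sinh_div_cosh
    rw [hfun]
    refine hd.congr_deriv ?_
    rw [Pi.div_apply]
    field_simp
  exact_mod_cast h.ofReal_comp

lemma hasDerivAt_exp_mul_ofReal (c : ℂ) (x : ℝ) :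
    HasDerivAt (fun y : ℝ => Complex.exp (c * (y : ℂ))) (c * Complex.exp (c * x)) x := by
  have h := ((Complex.ofRealCLM.hasDerivAt (x := x)).const_mul c).cexp
  simpa [mul_comm] using h

lemma deriv_add_tanh_sq_mul_exp (a c : ℂ) (x : ℝ) :
    deriv (fun y : ℝ => (a + (Real.tanh y : ℂ)) ^ 2 * Complex.exp (c * (y : ℂ))) x =
      (2 * (a + (Real.tanh x : ℂ)) * (1 - (Real.tanh x : ℂ) ^ 2) +
        c * (a + (Real.tanh x : ℂ)) ^ 2) * Complex.exp (c * x) := by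
  rw [((((hasDerivAt_ofReal_tanh x).const_add a).fun_pow 2).fun_mul
    (hasDerivAt_exp_mul_ofReal c x)).deriv]
  push_cast
  ring

lemma deriv_sub_tanh_sq_mul_exp (a c : ℂ) (x : ℝ) :
    deriv (fun y : ℝ => (a - (Real.tanh y : ℂ)) ^ 2 * Complex.exp (c * (y : ℂ))) x =
      (-2 * (a - (Real.tanh x : ℂ)) * (1 - (Real.tanh x : ℂ) ^ 2) +
        c * (a - (Real.tanh x : ℂ)) ^ 2) * Complex.exp (c * x) := by
  rw [((((hasDerivAt_ofReal_tanh x).const_sub a).fun_pow 2).fun_mul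
    (hasDerivAt_exp_mul_ofReal c x)).deriv]
  push_cast
  ring

lemma deriv_neg_sech_sq_mul_exp (c : ℂ) (x : ℝ) :
    deriv (fun y : ℝ => -(sech y : ℂ) ^ 2 * Complex.exp (c * (y : ℂ))) x =
      (2 * (Real.tanh x : ℂ) - c) * (1 - (Real.tanh x : ℂ) ^ 2) * Complex.exp (c * x) := by
  simp only [ofReal_sech_sq]
  rw [((((hasDerivAt_ofReal_tanh x).fun_pow 2).const_sub 1).fun_neg.fun_mul
    (hasDerivAt_exp_mul_ofReal c x)).deriv]
  push_cast
  ring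

/-- Wronskian relations of the Jost-type solutions of `H(1)f = zf`:
`W[f₁,g₂] = 2z²μ`, `W[f₃,g₄] = −2z²ν`, `W[f₁,g₄] = 0`, `W[f₃,g₂] = 0`,
where `μ² = 1 − z` and `ν² = 1 + z`. -/
theorem wronskian_relations (z μ ν : ℂ) (hμ : μ ^ 2 = 1 - z) (hν : ν ^ 2 = 1 + z) (x : ℝ) :
    Wronskian (jostF1 μ) (jostG2 μ) x = 2 * z ^ 2 * μ ∧
    Wronskian (jostF3 ν) (jostG4 ν) x = -2 * z ^ 2 * ν ∧
    Wronskian (jostF1 μ) (jostG4 ν) x = 0 ∧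
    Wronskian (jostF3 ν) (jostG2 μ) x = 0 := by
  have hexp (c : ℂ) : Complex.exp (c * x) * Complex.exp (-c * x) = 1 := by
    rw [← Complex.exp_add]
    simp
  have hz : z = 1 - μ ^ 2 := by linear_combination hμ
  subst hz
  have hEμ := hexp μ
  have hEν := hexp ν
  simp only [Wronskian, jostF1, jostG2, jostF3, jostG4, deriv_add_tanh_sq_mul_exp,
    deriv_sub_tanh_sq_mul_exp, deriv_neg_sech_sq_mul_exp]
  simp only [ofReal_sech_sq]
  generalize (Real.tanh x : ℂ) = t
  generalize Complex.exp (μ * x) = A at *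
  generalize Complex.exp (-μ * x) = A' at *
  generalize Complex.exp (ν * x) = B at *
  generalize Complex.exp (-ν * x) = B' at *
  refine ⟨?_, ?_, ?_, ?_⟩
  · linear_combination 2 * (1 - μ ^ 2) ^ 2 * μ * hEμ
  · linear_combination -2 * (ν ^ 2 - 1) ^ 2 * ν * hEν - 2 * ν * (ν ^ 2 - μ ^ 2) * hν
  · linear_combination (-(μ - ν) * (1 - t ^ 2) * A * B) * hν
  · linear_combination ((ν - μ) * (1 - t ^ 2) * A' * B') * hν
end

section
/- Fix ω > 0. For all ξ₁, ξ₂ ∈ ℝ with ξ₁ + ξ₂ ≠ 0, one has ∫_ℝ ( Ψ₁,ω(x,ξ₁) Ψ₁,ω(x,ξ₂) − Ψ₂,ω(x,ξ₁) Ψ₂,ω(x,ξ₂) ) φ_ω(x)² dx = (ξ₁² + ξ₂² + 2ω) · (1/12) · ( (ξ₁² − 4ξ₁ξ₂ + ξ₂² − 2ω) / ( (|ξ₁| − i√ω)² (|ξ₂| − i√ω)² ) ) · (ξ₁ + ξ₂) · cosech( (π/2) · (ξ₁+ξ₂)/√ω ). In particular, this quadratic spectral distribution carries the null factor (ξ₁²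 + ξ₂² + 2ω). -/
open MeasureTheory

/-- `cosech y = 1 / sinh y`. -/
noncomputable def cosech (y : ℝ) : ℝ := 1 / Real.sinh y

/-- The ground state `φ_ω(x) = √(2ω) sech(√ω x)`. -/
noncomputable def phi (ω x : ℝ) : ℝ := Real.sqrt (2 * ω) * sech (Real.sqrt ω * x)

/-- `Ψ₁,ω(x,ξ) = (2π)^{−1/2} (ξ + i√ω tanh(√ω x))² (|ξ| − i√ω)^{−2} e^{ixξ}`. -/
noncomputable def Psi1 (ω x ξ : ℝ) : ℂ :=
  ((Real.sqrt (2 * Real.pi) : ℝ) : ℂ)⁻¹ *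
    ((ξ : ℂ) + Complex.I * ((Real.sqrt ω : ℝ) : ℂ) *
        ((Real.tanh (Real.sqrt ω * x) : ℝ) : ℂ)) ^ 2 /
      (((|ξ| : ℝ) : ℂ) - Complex.I * ((Real.sqrt ω : ℝ) : ℂ)) ^ 2 *
    Complex.exp (Complex.I * x * ξ)

/-- `Ψ₂,ω(x,ξ) = (2π)^{−1/2} ω sech²(√ω x) (|ξ| − i√ω)^{−2} e^{ixξ}`. -/
noncomputable def Psi2 (ω x ξ : ℝ) : ℂ :=
  ((Real.sqrt (2 * Real.pi) : ℝ) : ℂ)⁻¹ *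
    ((ω : ℂ) * ((sech (Real.sqrt ω * x) ^ 2 : ℝ) : ℂ)) /
      (((|ξ| : ℝ) : ℂ) - Complex.I * ((Real.sqrt ω : ℝ) : ℂ)) ^ 2 *
    Complex.exp (Complex.I * x * ξ)

theorem sech_sq_add_tanh_sq (y : ℝ) : sech y ^ 2 + Real.tanh y ^ 2 = 1 := by
  have hc := (Real.cosh_pos y).ne'
  rw [sech, Real.tanh_eq_sinh_div_cosh]
  field_simp
  linarith [Real.cosh_sq y]

theorem hasDerivAt_tanh (y : ℝ) : HasDerivAt Real.tanh (sech y ^ 2) y := by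
  have hc := (Real.cosh_pos y).ne'
  rw [funext Real.tanh_eq_sinh_div_cosh]
  refine ((Real.hasDerivAt_sinh y).div (Real.hasDerivAt_cosh y) hc).congr_deriv ?_
  rw [sech]
  field_simp
  linarith [Real.cosh_sq y]

theorem hasDerivAt_sech (y : ℝ) : HasDerivAt sech (-(sech y * Real.tanh y)) y := by
  have hc := (Real.cosh_pos y).ne'
  have hs : sech = fun x => (Real.cosh x)⁻¹ := funext fun x => one_div _
  rw [hs]
  refine ((Real.hasDerivAt_cosh y).inv hc).congr_deriv ?_
  rw [Real.tanh_eq_sinh_div_cosh]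
  field_simp

theorem continuous_tanh : Continuous Real.tanh :=
  continuous_iff_continuousAt.2 fun y => (hasDerivAt_tanh y).continuousAt

theorem continuous_sech : Continuous sech :=
  continuous_iff_continuousAt.2 fun y => (hasDerivAt_sech y).continuousAt

theorem sigmoid_two_mul (y : ℝ) : Real.sigmoid (2 * y) = Real.exp y / (2 * Real.cosh y) := by
  rw [Real.sigmoid_def, Real.cosh_eq, eq_div_iff (by positivity), inv_mul_eq_iff_eq_mul₀
    (by positivity), add_mul, ← Real.exp_add]
  ring_nf

theorem one_sub_sigmoid_two_mul (y : ℝ) :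
    1 - Real.sigmoid (2 * y) = Real.exp (-y) / (2 * Real.cosh y) := by
  rw [← Real.sigmoid_neg, ← mul_neg, sigmoid_two_mul, Real.cosh_neg]

theorem hasDerivAt_sigmoid_two_mul (y : ℝ) :
    HasDerivAt (fun x => Real.sigmoid (2 * x)) (sech y ^ 2 / 2) y := by
  refine ((Real.hasDerivAt_sigmoid (2 * y)).comp y
    ((hasDerivAt_id y).const_mul 2)).congr_deriv ?_
  have hc := (Real.cosh_pos y).ne'
  rw [one_sub_sigmoid_two_mul, sigmoid_two_mul, sech, Real.exp_neg]
  field_simp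

theorem image_sigmoid_two_mul :
    (fun x : ℝ => Real.sigmoid (2 * x)) '' Set.univ = Set.Ioo 0 1 := by
  rw [Set.image_univ, ← Real.range_sigmoid]
  exact (mul_left_surjective₀ (two_ne_zero (α := ℝ))).range_comp Real.sigmoid

theorem injective_sigmoid_two_mul : Function.Injective fun x : ℝ => Real.sigmoid (2 * x) :=
  Real.sigmoid_injective.comp (mul_right_injective₀ two_ne_zero)

theorem integrable_sech_sq : Integrable fun y : ℝ => sech y ^ 2 := by
  have h := integrableOn_image_iff_integrableOn_abs_deriv_smul MeasurableSet.univ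
    (fun y _ => (hasDerivAt_sigmoid_two_mul y).hasDerivWithinAt)
    injective_sigmoid_two_mul.injOn (fun _ => (2 : ℝ))
  rw [image_sigmoid_two_mul, integrableOn_univ] at h
  refine (h.1 (integrableOn_const (by simp))).congr (.of_forall fun y => ?_)
  simp only [smul_eq_mul, abs_of_nonneg (div_nonneg (sq_nonneg (sech y)) zero_le_two)]
  ring

theorem integral_sech_sq_mul_exp_eq_betaIntegral (k : ℝ) :
    (∫ y : ℝ, ((sech y : ℝ) : ℂ) ^ 2 * Complex.exp (Complex.I * k * y)) =
      2 * Complex.betaIntegral (1 + Complex.I * k / 2) (1 - Complex.I * k / 2) := by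
  have h := integral_image_eq_integral_abs_deriv_smul MeasurableSet.univ
    (fun y _ => (hasDerivAt_sigmoid_two_mul y).hasDerivWithinAt)
    injective_sigmoid_two_mul.injOn
    (fun x : ℝ => (x : ℂ) ^ (1 + Complex.I * k / 2 - 1) *
      (1 - (x : ℂ)) ^ (1 - Complex.I * k / 2 - 1))
  rw [image_sigmoid_two_mul, setIntegral_univ] at h
  rw [Complex.betaIntegral, intervalIntegral.integral_of_le zero_le_one,
    integral_Ioc_eq_integral_Ioo, h, ← integral_const_mul]
  congr 1 with y
  have hc : (0 : ℝ) < 2 * Real.cosh y := mul_pos two_pos (Real.cosh_pos y)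
  have h1 : (0 : ℝ) < Real.exp y / (2 * Real.cosh y) := div_pos (Real.exp_pos y) hc
  have h2 : (0 : ℝ) < Real.exp (-y) / (2 * Real.cosh y) := div_pos (Real.exp_pos _) hc
  have e : (1 - ((Real.sigmoid (2 * y) : ℝ) : ℂ)) =
      ((Real.exp (-y) / (2 * Real.cosh y) : ℝ) : ℂ) := by
    rw [← one_sub_sigmoid_two_mul]
    push_cast
    ring
  rw [e, sigmoid_two_mul, Complex.cpow_def_of_ne_zero (by exact_mod_cast h1.ne'),
    Complex.cpow_def_of_ne_zero (by exact_mod_cast h2.ne'), ← Complex.ofReal_log h1.le,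
    ← Complex.ofReal_log h2.le, ← Complex.exp_add,
    Real.log_div (Real.exp_pos _).ne' hc.ne', Real.log_div (Real.exp_pos _).ne' hc.ne',
    Real.log_exp, Real.log_exp, abs_of_nonneg (div_nonneg (sq_nonneg (sech y)) zero_le_two),
    Complex.real_smul]
  have hexp : ((y - Real.log (2 * Real.cosh y) : ℝ) : ℂ) * (1 + Complex.I * k / 2 - 1) +
      ((-y - Real.log (2 * Real.cosh y) : ℝ) : ℂ) * (1 - Complex.I * k / 2 - 1) =
      Complex.I * k * y := by
    push_cast
    ring
  rw [hexp]
  push_cast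
  ring

/-- The Fourier transform of `sech²`. -/
theorem integral_sech_sq_mul_exp {k : ℝ} (hk : k ≠ 0) :
    (∫ y : ℝ, ((sech y : ℝ) : ℂ) ^ 2 * Complex.exp (Complex.I * k * y)) =
      ((Real.pi * k * cosech (Real.pi / 2 * k) : ℝ) : ℂ) := by
  have hz : Complex.I * k / 2 ≠ 0 := by simp [hk]
  rw [integral_sech_sq_mul_exp_eq_betaIntegral,
    Complex.betaIntegral_eq_Gamma_mul_div _ _ (by simp) (by simp),
    add_comm (1 : ℂ) (Complex.I * k / 2), Complex.Gamma_add_one _ hz, mul_assoc (Complex.I * k / 2),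
    Complex.Gamma_mul_Gamma_one_sub]
  have h2 : Complex.Gamma (Complex.I * k / 2 + 1 + (1 - Complex.I * k / 2)) = 1 := by
    rw [show Complex.I * k / 2 + 1 + (1 - Complex.I * k / 2) = ((1 : ℕ) : ℂ) + 1 by push_cast; ring,
      Complex.Gamma_nat_eq_factorial]
    simp
  have hs : Complex.sin (Real.pi * (Complex.I * k / 2)) =
      ((Real.sinh (Real.pi / 2 * k) : ℝ) : ℂ) * Complex.I := by
    rw [show (Real.pi * (Complex.I * k / 2) : ℂ) = ((Real.pi / 2 * k : ℝ) : ℂ) * Complex.I by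
      push_cast; ring, Complex.sin_mul_I, Complex.ofReal_sinh]
  have hsinh : Real.sinh (Real.pi / 2 * k) ≠ 0 :=
    Real.sinh_ne_zero.2 (mul_ne_zero (by positivity) hk)
  have hsinh' : ((Real.sinh (Real.pi / 2 * k) : ℝ) : ℂ) ≠ 0 := by exact_mod_cast hsinh
  rw [h2, hs, cosech, Complex.ofReal_mul, Complex.ofReal_div]
  push_cast [-Complex.ofReal_sinh]
  field_simp [Complex.I_ne_zero]

theorem integrable_sech_sq_mul_exp (k : ℝ) :
    Integrable fun y : ℝ => ((sech y : ℝ) : ℂ) ^ 2 * Complex.exp (Complex.I * k * y) := by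
  have hS := continuous_sech
  refine integrable_sech_sq.mono' (by fun_prop) (.of_forall fun y => ?_)
  rw [norm_mul, Complex.norm_exp]
  simp

/-- A continuous function of `(tanh, sech)` is bounded, hence integrable against `sech² e^{iky}`. -/
theorem integrable_sech_sq_mul_exp_mul {G : ℝ × ℝ → ℂ} (hG : Continuous G) (k : ℝ) :
    Integrable fun y : ℝ =>
      ((sech y : ℝ) : ℂ) ^ 2 * Complex.exp (Complex.I * k * y) * G (Real.tanh y, sech y) := by
  obtain ⟨C, hC⟩ := ((isCompact_Icc (a := (-1 : ℝ)) (b := 1)).prod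
    (isCompact_Icc (a := (-1 : ℝ)) (b := 1))).exists_bound_of_continuousOn hG.continuousOn
  refine (integrable_sech_sq_mul_exp k).mul_bdd (c := C)
    (hG.comp (continuous_tanh.prodMk continuous_sech)).aestronglyMeasurable
    (.of_forall fun y => hC _ ⟨?_, ?_⟩)
  · exact abs_le.1 (abs_le_of_sq_le_sq (by nlinarith [sech_sq_add_tanh_sq y]) zero_le_one)
  · exact abs_le.1 (abs_le_of_sq_le_sq (by nlinarith [sech_sq_add_tanh_sq y]) zero_le_one)

theorem hasDerivAt_sech_sq_mul_exp_mul (α β γ : ℂ) (k y : ℝ) :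
    HasDerivAt (fun x : ℝ => ((sech x : ℝ) : ℂ) ^ 2 * Complex.exp (Complex.I * k * x) *
        (α + β * ((Real.tanh x : ℝ) : ℂ) + γ * ((sech x : ℝ) : ℂ) ^ 2))
      (((sech y : ℝ) : ℂ) ^ 2 * Complex.exp (Complex.I * k * y) *
        ((Complex.I * k - 2 * ((Real.tanh y : ℝ) : ℂ)) *
            (α + β * ((Real.tanh y : ℝ) : ℂ) + γ * ((sech y : ℝ) : ℂ) ^ 2) +
          ((sech y : ℝ) : ℂ) ^ 2 * (β - 2 * γ * ((Real.tanh y : ℝ) : ℂ)))) y := by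
  have hS := (hasDerivAt_sech y).ofReal_comp
  have hT := (hasDerivAt_tanh y).ofReal_comp
  have hE := ((hasDerivAt_id y).ofReal_comp.const_mul (Complex.I * k)).cexp
  refine (((hS.pow 2).mul hE).mul
    (((hT.const_mul β).const_add α).add ((hS.pow 2).const_mul γ))).congr_deriv ?_
  simp only [Pi.mul_apply, Pi.pow_apply, Pi.add_apply, id]
  push_cast
  ring

/-- The integrand differs from a multiple of `sech² e^{iky}` by an exact derivative, so its integral
is that multiple of the Fourier transform of `sech²`. -/
theorem integral_distorted_product {a b : ℝ} (h : a + b ≠ 0) :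
    (∫ y : ℝ, (((a : ℂ) + Complex.I * ((Real.tanh y : ℝ) : ℂ)) ^ 2 *
        ((b : ℂ) + Complex.I * ((Real.tanh y : ℝ) : ℂ)) ^ 2 - ((sech y : ℝ) : ℂ) ^ 4) *
        ((sech y : ℝ) : ℂ) ^ 2 * Complex.exp (Complex.I * ((a + b : ℝ) : ℂ) * y)) =
      (a ^ 2 + b ^ 2 + 2) * (a ^ 2 - 4 * a * b + b ^ 2 - 2) / 12 *
        ((Real.pi * (a + b) * cosech (Real.pi / 2 * (a + b)) : ℝ) : ℂ) := by
  set β : ℂ := (4 * (a * b - 1) + (a + b) ^ 2) / 6 with hβ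
  set α : ℂ := Complex.I * (a + b) * (β - 2 * (a * b - 1)) / 2 with hα
  set γ : ℂ := -(Complex.I * (a + b)) / 2 with hγ
  have hF' := integrable_sech_sq_mul_exp_mul (G := fun q : ℝ × ℝ =>
    (Complex.I * (a + b : ℝ) - 2 * (q.1 : ℂ)) * (α + β * (q.1 : ℂ) + γ * (q.2 : ℂ) ^ 2) +
      (q.2 : ℂ) ^ 2 * (β - 2 * γ * (q.1 : ℂ))) (by fun_prop) (a + b)
  have hF := integral_eq_zero_of_hasDerivAt_of_integrable
    (hasDerivAt_sech_sq_mul_exp_mul α β γ (a + b)) hF'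
    (integrable_sech_sq_mul_exp_mul (G := fun q : ℝ × ℝ =>
      α + β * (q.1 : ℂ) + γ * (q.2 : ℂ) ^ 2) (by fun_prop) (a + b))
  rw [← integral_sech_sq_mul_exp h, ← integral_const_mul]
  refine Eq.trans ?_ ((integral_add ((integrable_sech_sq_mul_exp _).const_mul _) hF').trans
    ((congrArg _ hF).trans (add_zero _)))
  congr 1 with y
  have hST : ((Real.tanh y : ℝ) : ℂ) ^ 2 = 1 - ((sech y : ℝ) : ℂ) ^ 2 :=
    eq_sub_of_add_eq' (by exact_mod_cast sech_sq_add_tanh_sq y)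
  have hI := Complex.I_sq
  push_cast [-Complex.ofReal_tanh]
  generalize Complex.exp _ = E
  generalize ((Real.tanh y : ℝ) : ℂ) = T at *
  generalize ((sech y : ℝ) : ℂ) = S at *
  have hpoly : ((a : ℂ) + Complex.I * T) ^ 2 * (b + Complex.I * T) ^ 2 - S ^ 4 =
      (a ^ 2 + b ^ 2 + 2) * (a ^ 2 - 4 * a * b + b ^ 2 - 2) / 12 +
      ((Complex.I * (a + b) - 2 * T) * (α + β * T + γ * S ^ 2) +
        S ^ 2 * (β - 2 * γ * T)) := by
    rw [hα, hγ, hβ]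
    generalize Complex.I = J at *
    grind
  rw [hpoly]
  ring

/-- The quadratic spectral distribution `ν_{++,ω}` carries the null factor
`(ξ₁² + ξ₂² + 2ω)`:
`∫ (Ψ₁,ω(x,ξ₁)Ψ₁,ω(x,ξ₂) − Ψ₂,ω(x,ξ₁)Ψ₂,ω(x,ξ₂)) φ_ω(x)² dx
  = (ξ₁² + ξ₂² + 2ω) (1/12) (ξ₁² − 4ξ₁ξ₂ + ξ₂² − 2ω)/((|ξ₁| − i√ω)²(|ξ₂| − i√ω)²)
      (ξ₁ + ξ₂) cosech((π/2)(ξ₁+ξ₂)/√ω)`. -/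
theorem quadratic_spectral_distribution_plus_plus (ω : ℝ) (hω : 0 < ω) (ξ₁ ξ₂ : ℝ)
    (h : ξ₁ + ξ₂ ≠ 0) :
    (∫ x : ℝ, (Psi1 ω x ξ₁ * Psi1 ω x ξ₂ - Psi2 ω x ξ₁ * Psi2 ω x ξ₂) *
        ((phi ω x ^ 2 : ℝ) : ℂ)) =
      ((ξ₁ ^ 2 + ξ₂ ^ 2 + 2 * ω : ℝ) : ℂ) * (1 / 12 : ℂ) *
        (((ξ₁ ^ 2 - 4 * ξ₁ * ξ₂ + ξ₂ ^ 2 - 2 * ω : ℝ) : ℂ) /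
          ((((|ξ₁| : ℝ) : ℂ) - Complex.I * ((Real.sqrt ω : ℝ) : ℂ)) ^ 2 *
            (((|ξ₂| : ℝ) : ℂ) - Complex.I * ((Real.sqrt ω : ℝ) : ℂ)) ^ 2)) *
        ((ξ₁ + ξ₂ : ℝ) : ℂ) *
        ((cosech (Real.pi / 2 * ((ξ₁ + ξ₂) / Real.sqrt ω)) : ℝ) : ℂ) := by
  have hs : 0 < Real.sqrt ω := Real.sqrt_pos.2 hω
  have hsq : ((Real.sqrt ω : ℝ) : ℂ) ^ 2 = ω := by exact_mod_cast Real.sq_sqrt hω.le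
  have hs' : ((Real.sqrt ω : ℝ) : ℂ) ≠ 0 := by exact_mod_cast hs.ne'
  have hπ : (Real.sqrt (2 * Real.pi) : ℂ) ^ 2 = 2 * Real.pi := by
    exact_mod_cast Real.sq_sqrt (by positivity : 0 ≤ 2 * Real.pi)
  have hπ' : ((Real.sqrt (2 * Real.pi) : ℝ) : ℂ) ≠ 0 := by
    exact_mod_cast (Real.sqrt_pos.2 (by positivity)).ne'
  have hπ0 : (Real.pi : ℂ) ≠ 0 := by exact_mod_cast Real.pi_ne_zero
  have hD (ξ : ℝ) : ((|ξ| : ℝ) : ℂ) - Complex.I * ((Real.sqrt ω : ℝ) : ℂ) ≠ 0 := fun h0 => by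
    have := congrArg Complex.im h0
    simp [hs.ne'] at this
  have hD₁ := hD ξ₁
  have hD₂ := hD ξ₂
  have hk : ξ₁ / Real.sqrt ω + ξ₂ / Real.sqrt ω ≠ 0 := by
    rw [← add_div]
    exact div_ne_zero h hs.ne'
  have key := integral_distorted_product hk
  set g : ℝ → ℂ := fun y => ((((ξ₁ / Real.sqrt ω : ℝ) : ℂ) +
      Complex.I * ((Real.tanh y : ℝ) : ℂ)) ^ 2 *
    (((ξ₂ / Real.sqrt ω : ℝ) : ℂ) + Complex.I * ((Real.tanh y : ℝ) : ℂ)) ^ 2 -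
      ((sech y : ℝ) : ℂ) ^ 4) * ((sech y : ℝ) : ℂ) ^ 2 *
    Complex.exp (Complex.I * ((ξ₁ / Real.sqrt ω + ξ₂ / Real.sqrt ω : ℝ) : ℂ) * y) with hg
  have hint (x : ℝ) : (Psi1 ω x ξ₁ * Psi1 ω x ξ₂ - Psi2 ω x ξ₁ * Psi2 ω x ξ₂) *
        ((phi ω x ^ 2 : ℝ) : ℂ) =
      (ω ^ 3 / Real.pi /
        ((((|ξ₁| : ℝ) : ℂ) - Complex.I * ((Real.sqrt ω : ℝ) : ℂ)) ^ 2 *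
            (((|ξ₂| : ℝ) : ℂ) - Complex.I * ((Real.sqrt ω : ℝ) : ℂ)) ^ 2)) *
        g (Real.sqrt ω * x) := by
    have hE : Complex.exp (Complex.I * ((ξ₁ / Real.sqrt ω + ξ₂ / Real.sqrt ω : ℝ) : ℂ) *
        ((Real.sqrt ω * x : ℝ) : ℂ)) =
        Complex.exp (Complex.I * x * ξ₁) * Complex.exp (Complex.I * x * ξ₂) := by
      rw [← Complex.exp_add]
      congr 1
      push_cast
      field_simp
    have hφ : ((phi ω x ^ 2 : ℝ) : ℂ) = 2 * ω * ((sech (Real.sqrt ω * x) : ℝ) : ℂ) ^ 2 := by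
      rw [phi, mul_pow, Real.sq_sqrt (by positivity)]
      push_cast
      ring
    simp only [hg]
    rw [hE, hφ, Psi1, Psi1, Psi2, Psi2]
    push_cast [-Complex.ofReal_tanh]
    generalize ((Real.tanh (Real.sqrt ω * x) : ℝ) : ℂ) = T
    generalize ((sech (Real.sqrt ω * x) : ℝ) : ℂ) = S
    generalize ((|ξ₁| : ℝ) : ℂ) - Complex.I * ((Real.sqrt ω : ℝ) : ℂ) = D₁ at *
    generalize ((|ξ₂| : ℝ) : ℂ) - Complex.I * ((Real.sqrt ω : ℝ) : ℂ) = D₂ at *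
    generalize Complex.exp (Complex.I * x * ξ₁) = E₁
    generalize Complex.exp (Complex.I * x * ξ₂) = E₂
    generalize ((Real.sqrt ω : ℝ) : ℂ) = s at *
    generalize ((Real.sqrt (2 * Real.pi) : ℝ) : ℂ) = q at *
    rw [← hsq]
    field_simp
    rw [hπ]
    ring
  simp_rw [hint]
  rw [integral_const_mul, Measure.integral_comp_mul_left, key, abs_of_pos (inv_pos.2 hs),
    ← add_div, Complex.real_smul]
  push_cast
  generalize ((Real.sqrt ω : ℝ) : ℂ) = s at *
  rw [← hsq]
  field_simp
end
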